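/- For all multi-indices I, J and every index a ∈ {1,2,3} there exists a constant C > 0 such that for every smooth function u on {(t,x) ∈ ℝ × ℝ³ : t > 0} and every point (t,x) with t ≥ 1 and |x| ≤ t, one has |∂^I L^J ( (xᵃ/t)∂_t u + ∂_a u )(t,x)| ≤ C t^{-1} Σ_{|I'| ≤ |I|, |J'| ≤ |J|} |∂^{I'} L^{J'} (L_a u)(t,x)|; i.e., the semi-hyperboloidal derivative ∂̲_a u = (xᵃ/t)∂_t u + ∂_a u and its admissible derivatives are controlled, with a factor t^{-1}, by the boosts and translations applied to L_a u. -/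

import Mathlib

noncomputable section

/-- Euclidean 3-space. -/
abbrev E3 := EuclideanSpace ℝ (Fin 3)

/-- The coordinate directions of `ℝ × ℝ³` (index `0` is time). -/
def dir4 : Fin 4 → ℝ × E3 :=
  ![(1, 0), (0, EuclideanSpace.single 0 1), (0, EuclideanSpace.single 1 1),
    (0, EuclideanSpace.single 2 1)]

/-- The translation field `∂_α` (with `∂_0 = ∂_t`). -/
def pd (α : Fin 4) (u : ℝ × E3 → ℝ) : ℝ × E3 → ℝ := fun p => fderiv ℝ u p (dir4 α)

/-- The Lorentz boost `L_a = xᵃ∂_t + t∂_a`. -/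
def Lb (a : Fin 3) (u : ℝ × E3 → ℝ) : ℝ × E3 → ℝ :=
  fun p => p.2 a * fderiv ℝ u p (1, 0) + p.1 * fderiv ℝ u p (0, EuclideanSpace.single a 1)

/-- The semi-hyperboloidal frame field `∂̲_a = (xᵃ/t)∂_t + ∂_a`. -/
def sh (a : Fin 3) (u : ℝ × E3 → ℝ) : ℝ × E3 → ℝ :=
  fun p => p.2 a / p.1 * fderiv ℝ u p (1, 0) + fderiv ℝ u p (0, EuclideanSpace.single a 1)

/-- The composition `∂^I` of translations prescribed by `I : Fin m → Fin 4`. -/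
def pdF {m : ℕ} (I : Fin m → Fin 4) (u : ℝ × E3 → ℝ) : ℝ × E3 → ℝ :=
  (List.ofFn I).foldr pd u

/-- The composition `L^J` of Lorentz boosts prescribed by `J : Fin n → Fin 3`. -/
def LbF {n : ℕ} (J : Fin n → Fin 3) (u : ℝ × E3 → ℝ) : ℝ × E3 → ℝ :=
  (List.ofFn J).foldr Lb u

open Set

/-- The half-space `t > 0`. -/
def halfSpace : Set (ℝ × E3) := {p | 0 < p.1}

/-- Smoothness on the half-space `t > 0`. -/
def SmoothOnHalf (f : ℝ × E3 → ℝ) : Prop := ContDiffOn ℝ (⊤ : ℕ∞) f halfSpace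

/-- The derivative of `f` along the vector field `ξ`. -/
def alongField (ξ : ℝ × E3 → ℝ × E3) (f : ℝ × E3 → ℝ) : ℝ × E3 → ℝ :=
  fun p => fderiv ℝ f p (ξ p)

/-- The vector field of the boost `L_a`. -/
def boostField (a : Fin 3) (p : ℝ × E3) : ℝ × E3 :=
  p.2 a • (1, 0) + p.1 • (0, EuclideanSpace.single a 1)

/-- The algebra of functions generated by `t⁻¹` and the `xᶜ/t`. -/
inductive IsSymbol : (ℝ × E3 → ℝ) → Prop
  | const (c : ℝ) : IsSymbol fun _ => c
  | inv_time : IsSymbol fun p => p.1⁻¹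
  | ratio (c : Fin 3) : IsSymbol fun p => p.2 c * p.1⁻¹
  | add {f g} : IsSymbol f → IsSymbol g → IsSymbol fun p => f p + g p
  | mul {f g} : IsSymbol f → IsSymbol g → IsSymbol fun p => f p * g p

/-- Smooth vector fields whose coefficients are `t` times a symbol. -/
structure IsAdmissible (ξ : ℝ × E3 → ℝ × E3) : Prop where
  contDiff : ContDiff ℝ (⊤ : ℕ∞) ξ
  time : ∃ g, IsSymbol g ∧ EqOn (fun p => (ξ p).1 * p.1⁻¹) g halfSpace
  space : ∀ c, ∃ g, IsSymbol g ∧ EqOn (fun p => (ξ p).2 c * p.1⁻¹) g halfSpace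

/-- Finite sums of operators `t⁻¹ g D` with `g` a symbol and `D ∈ S`. -/
inductive IsCombination (S : Set ((ℝ × E3 → ℝ) → ℝ × E3 → ℝ)) :
    ((ℝ × E3 → ℝ) → ℝ × E3 → ℝ) → Prop
  | term {g D} : IsSymbol g → D ∈ S → IsCombination S fun v p => p.1⁻¹ * (g p * D v p)
  | add {T T'} : IsCombination S T → IsCombination S T' →
      IsCombination S fun v p => T v p + T' v p

/-- The operators `∂^I L^J` with `|I| ≤ m` and `|J| ≤ n`. -/
def pdLbOps (m n : ℕ) : Set ((ℝ × E3 → ℝ) → ℝ × E3 → ℝ) :=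
  {D | ∃ (l₁ : List (Fin 4)) (l₂ : List (Fin 3)), l₁.length ≤ m ∧ l₂.length ≤ n ∧
    D = fun v => l₁.foldr pd (l₂.foldr Lb v)}

lemma isOpen_halfSpace : IsOpen halfSpace := isOpen_lt continuous_const continuous_fst

lemma Lb_eq_alongField (a : Fin 3) : Lb a = alongField (boostField a) := by
  funext u p
  simp only [Lb, alongField, boostField, map_add, map_smul, smul_eq_mul]

lemma SmoothOnHalf.differentiableAt {f : ℝ × E3 → ℝ} (hf : SmoothOnHalf f) {p : ℝ × E3}
    (hp : p ∈ halfSpace) : DifferentiableAt ℝ f p :=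
  (hf.contDiffAt (isOpen_halfSpace.mem_nhds hp)).differentiableAt (by simp)

lemma SmoothOnHalf.alongField {f : ℝ × E3 → ℝ} (hf : SmoothOnHalf f) {ξ : ℝ × E3 → ℝ × E3}
    (hξ : ContDiff ℝ (⊤ : ℕ∞) ξ) : SmoothOnHalf (alongField ξ f) :=
  (hf.fderiv_of_isOpen isOpen_halfSpace (by simp)).clm_apply hξ.contDiffOn

lemma SmoothOnHalf.add {f g : ℝ × E3 → ℝ} (hf : SmoothOnHalf f) (hg : SmoothOnHalf g) :
    SmoothOnHalf fun p => f p + g p := ContDiffOn.add hf hg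

lemma SmoothOnHalf.mul {f g : ℝ × E3 → ℝ} (hf : SmoothOnHalf f) (hg : SmoothOnHalf g) :
    SmoothOnHalf fun p => f p * g p := ContDiffOn.mul hf hg

lemma smooth_inv_time : SmoothOnHalf fun p => p.1⁻¹ :=
  contDiff_fst.contDiffOn.inv fun _ hp => ne_of_gt hp

lemma contDiff_coord (c : Fin 3) : ContDiff ℝ (⊤ : ℕ∞) fun p : ℝ × E3 => p.2 c :=
  (EuclideanSpace.proj (𝕜 := ℝ) c).contDiff.comp contDiff_snd

lemma smooth_coord (c : Fin 3) : SmoothOnHalf fun p => p.2 c := (contDiff_coord c).contDiffOn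

lemma alongField_congr {f g : ℝ × E3 → ℝ} (h : EqOn f g halfSpace) (ξ : ℝ × E3 → ℝ × E3) :
    EqOn (alongField ξ f) (alongField ξ g) halfSpace := by
  intro p hp
  simp only [alongField, (h.eventuallyEq_of_mem (isOpen_halfSpace.mem_nhds hp)).fderiv_eq]

lemma alongField_add {f g : ℝ × E3 → ℝ} (hf : SmoothOnHalf f) (hg : SmoothOnHalf g)
    (ξ : ℝ × E3 → ℝ × E3) {p : ℝ × E3} (hp : p ∈ halfSpace) :
    alongField ξ (fun q => f q + g q) p = alongField ξ f p + alongField ξ g p := by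
  simp [alongField, fderiv_fun_add (hf.differentiableAt hp) (hg.differentiableAt hp)]

lemma alongField_mul {f g : ℝ × E3 → ℝ} (hf : SmoothOnHalf f) (hg : SmoothOnHalf g)
    (ξ : ℝ × E3 → ℝ × E3) {p : ℝ × E3} (hp : p ∈ halfSpace) :
    alongField ξ (fun q => f q * g q) p = alongField ξ f p * g p + f p * alongField ξ g p := by
  simp [alongField, fderiv_fun_mul (hf.differentiableAt hp) (hg.differentiableAt hp)]
  ring

lemma alongField_coord (ξ : ℝ × E3 → ℝ × E3) (c : Fin 3) (p : ℝ × E3) :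
    alongField ξ (fun q => q.2 c) p = (ξ p).2 c := by
  have : HasFDerivAt (fun q : ℝ × E3 => q.2 c)
      ((EuclideanSpace.proj (𝕜 := ℝ) c).comp (ContinuousLinearMap.snd ℝ ℝ E3)) p :=
    ((EuclideanSpace.proj (𝕜 := ℝ) c).comp (ContinuousLinearMap.snd ℝ ℝ E3)).hasFDerivAt
  simp [alongField, this.fderiv]

lemma alongField_inv_time (ξ : ℝ × E3 → ℝ × E3) {p : ℝ × E3} (hp : p ∈ halfSpace) :
    alongField ξ (fun q => q.1⁻¹) p = -((ξ p).1 * p.1⁻¹) * p.1⁻¹ := by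
  have h0 : p.1 ≠ 0 := ne_of_gt hp
  have := (hasDerivAt_inv h0).comp_hasFDerivAt p (hasFDerivAt_fst (𝕜 := ℝ) (p := p))
  have h : fderiv ℝ (fun q : ℝ × E3 => q.1⁻¹) p = _ := this.fderiv
  simp only [alongField, h]
  simp
  field_simp

lemma isAdmissible_translation (α : Fin 4) : IsAdmissible fun _ => dir4 α where
  contDiff := contDiff_const
  time := ⟨_, (IsSymbol.const _).mul .inv_time, fun _ _ => rfl⟩
  space _ := ⟨_, (IsSymbol.const _).mul .inv_time, fun _ _ => rfl⟩

lemma isAdmissible_boost (a : Fin 3) : IsAdmissible (boostField a) where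
  contDiff := ((contDiff_coord a).smul contDiff_const).add (contDiff_fst.smul contDiff_const)
  time := ⟨_, .ratio a, fun p _ => by simp [boostField]⟩
  space c := ⟨_, .const ((EuclideanSpace.single a (1 : ℝ) : E3) c), fun p hp => by
    have h0 : p.1 ≠ 0 := ne_of_gt hp
    simp only [boostField, Prod.snd_add, Prod.smul_snd, smul_zero, zero_add, PiLp.smul_apply,
      smul_eq_mul]
    field_simp⟩

lemma smooth_Lb {u : ℝ × E3 → ℝ} (hu : SmoothOnHalf u) (a : Fin 3) : SmoothOnHalf (Lb a u) := by
  rw [Lb_eq_alongField]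
  exact hu.alongField (isAdmissible_boost a).contDiff

lemma smooth_foldr_Lb {u : ℝ × E3 → ℝ} (hu : SmoothOnHalf u) (l : List (Fin 3)) :
    SmoothOnHalf (l.foldr Lb u) := by
  induction l with
  | nil => exact hu
  | cons a l ih => exact smooth_Lb ih a

lemma smooth_foldr_pd {u : ℝ × E3 → ℝ} (hu : SmoothOnHalf u) (l : List (Fin 4)) :
    SmoothOnHalf (l.foldr pd u) := by
  induction l with
  | nil => exact hu
  | cons α l ih => exact ih.alongField contDiff_const

lemma foldr_Lb_congr {f g : ℝ × E3 → ℝ} (h : EqOn f g halfSpace) (l : List (Fin 3)) :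
    EqOn (l.foldr Lb f) (l.foldr Lb g) halfSpace := by
  induction l with
  | nil => exact h
  | cons a l ih =>
    simp only [List.foldr_cons, Lb_eq_alongField a]
    exact alongField_congr ih _

lemma foldr_pd_congr {f g : ℝ × E3 → ℝ} (h : EqOn f g halfSpace) (l : List (Fin 4)) :
    EqOn (l.foldr pd f) (l.foldr pd g) halfSpace := by
  induction l with
  | nil => exact h
  | cons α l ih => exact alongField_congr ih _

lemma IsSymbol.smooth {g : ℝ × E3 → ℝ} (hg : IsSymbol g) : SmoothOnHalf g := by
  induction hg with
  | const c => exact contDiffOn_const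
  | inv_time => exact smooth_inv_time
  | ratio c => exact (smooth_coord c).mul smooth_inv_time
  | add _ _ hf hg => exact hf.add hg
  | mul _ _ hf hg => exact hf.mul hg

lemma IsSymbol.exists_bound {g : ℝ × E3 → ℝ} (hg : IsSymbol g) :
    ∃ C : ℝ, 0 < C ∧ ∀ p : ℝ × E3, 1 ≤ p.1 → ‖p.2‖ ≤ p.1 → |g p| ≤ C := by
  induction hg with
  | const c => exact ⟨|c| + 1, by positivity, fun _ _ _ => by simp⟩
  | inv_time =>
    refine ⟨1, one_pos, fun p ht _ => ?_⟩
    rw [abs_of_nonneg (by positivity)]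
    exact inv_le_one_of_one_le₀ ht
  | ratio c =>
    refine ⟨1, one_pos, fun p ht hx => ?_⟩
    have hpos : 0 < p.1 := one_pos.trans_le ht
    have hc : |p.2 c| ≤ ‖p.2‖ := PiLp.norm_apply_le p.2 c
    change |p.2 c * p.1⁻¹| ≤ 1
    rw [← div_eq_mul_inv, abs_div, abs_of_pos hpos, div_le_one hpos]
    exact hc.trans hx
  | add _ _ hf hg =>
    obtain ⟨A, hA, hf⟩ := hf
    obtain ⟨B, hB, hg⟩ := hg
    exact ⟨A + B, by positivity, fun p ht hx =>
      (abs_add_le _ _).trans (add_le_add (hf p ht hx) (hg p ht hx))⟩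
  | mul _ _ hf hg =>
    obtain ⟨A, hA, hf⟩ := hf
    obtain ⟨B, hB, hg⟩ := hg
    refine ⟨A * B, by positivity, fun p ht hx => ?_⟩
    rw [abs_mul]
    exact mul_le_mul (hf p ht hx) (hg p ht hx) (abs_nonneg _) hA.le

lemma IsSymbol.exists_alongField {g : ℝ × E3 → ℝ} (hg : IsSymbol g)
    {ξ : ℝ × E3 → ℝ × E3} (hξ : IsAdmissible ξ) :
    ∃ g', IsSymbol g' ∧ EqOn (alongField ξ g) g' halfSpace := by
  obtain ⟨τ, hτ, hτξ⟩ := hξ.time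
  have hinv : ∀ p ∈ halfSpace, alongField ξ (fun q => q.1⁻¹) p = -1 * τ p * p.1⁻¹ := by
    intro p hp
    rw [alongField_inv_time ξ hp, ← hτξ hp]
    ring
  have hinvS : IsSymbol fun p => -1 * τ p * p.1⁻¹ := ((IsSymbol.const (-1)).mul hτ).mul .inv_time
  induction hg with
  | const c => exact ⟨_, .const 0, fun p _ => by simp [alongField]⟩
  | inv_time => exact ⟨_, hinvS, hinv⟩
  | ratio c =>
    obtain ⟨σ, hσ, hσξ⟩ := hξ.space c
    refine ⟨_, hσ.add (((IsSymbol.const (-1)).mul hτ).mul (.ratio c)), fun p hp => ?_⟩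
    have h := hσξ hp
    simp only at h
    rw [alongField_mul (smooth_coord c) smooth_inv_time ξ hp, hinv p hp, alongField_coord, h]
    ring
  | add hf hg ihf ihg =>
    obtain ⟨f', hf', hff'⟩ := ihf
    obtain ⟨g', hg', hgg'⟩ := ihg
    refine ⟨_, hf'.add hg', fun p hp => ?_⟩
    rw [alongField_add hf.smooth hg.smooth ξ hp, hff' hp, hgg' hp]
  | mul hf hg ihf ihg =>
    obtain ⟨f', hf', hff'⟩ := ihf
    obtain ⟨g', hg', hgg'⟩ := ihg
    refine ⟨_, (hf'.mul hg).add (hf.mul hg'), fun p hp => ?_⟩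
    rw [alongField_mul hf.smooth hg.smooth ξ hp, hff' hp, hgg' hp]

section Combination

variable {S S' : Set ((ℝ × E3 → ℝ) → ℝ × E3 → ℝ)} {T : (ℝ × E3 → ℝ) → ℝ × E3 → ℝ}

lemma IsCombination.smooth (hT : IsCombination S T) {v : ℝ × E3 → ℝ}
    (hS : ∀ D ∈ S, SmoothOnHalf (D v)) : SmoothOnHalf (T v) := by
  induction hT with
  | term hg hD => exact smooth_inv_time.mul (hg.smooth.mul (hS _ hD))
  | add _ _ h h' => exact h.add h'

/-- The constant depends on the combination only, not on the function it is applied to. -/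
lemma IsCombination.exists_bound (hT : IsCombination S T) :
    ∃ C : ℝ, 0 < C ∧ ∀ (v : ℝ × E3 → ℝ) (M : ℝ) (p : ℝ × E3), 1 ≤ p.1 → ‖p.2‖ ≤ p.1 →
      (∀ D ∈ S, |D v p| ≤ M) → |T v p| ≤ C * p.1⁻¹ * M := by
  induction hT with
  | @term g D hg hD =>
    obtain ⟨C, hC, h⟩ := hg.exists_bound
    refine ⟨C, hC, fun v M p ht hx hM => ?_⟩
    have hpos : 0 < p.1 := one_pos.trans_le ht
    rw [abs_mul, abs_mul, abs_of_pos (inv_pos.2 hpos), mul_comm C, mul_assoc]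
    gcongr
    · exact h p ht hx
    · exact hM D hD
  | add _ _ h h' =>
    obtain ⟨A, hA, h⟩ := h
    obtain ⟨B, hB, h'⟩ := h'
    refine ⟨A + B, by positivity, fun v M p ht hx hM => ?_⟩
    rw [add_mul, add_mul]
    exact (abs_add_le _ _).trans (add_le_add (h v M p ht hx hM) (h' v M p ht hx hM))

lemma IsCombination.exists_alongField (hT : IsCombination S T) {ξ : ℝ × E3 → ℝ × E3}
    (hξ : IsAdmissible ξ) (hS : ∀ D ∈ S, ∀ v, SmoothOnHalf v → SmoothOnHalf (D v))
    (hSS' : S ⊆ S') (hS' : ∀ D ∈ S, (fun v => alongField ξ (D v)) ∈ S') :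
    ∃ T', IsCombination S' T' ∧
      ∀ v, SmoothOnHalf v → EqOn (alongField ξ (T v)) (T' v) halfSpace := by
  induction hT with
  | @term g D hg hD =>
    obtain ⟨τ, hτ, hτξ⟩ := hξ.time
    obtain ⟨g', hg', hgg'⟩ := hg.exists_alongField hξ
    refine ⟨_, (IsCombination.term ((((IsSymbol.const (-1)).mul hτ).mul hg).add hg')
      (hSS' hD)).add (.term hg (hS' D hD)), fun v hv p hp => ?_⟩
    have h := hτξ hp
    simp only at h
    rw [alongField_mul smooth_inv_time (hg.smooth.mul (hS D hD v hv)) ξ hp,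
      alongField_mul hg.smooth (hS D hD v hv) ξ hp, alongField_inv_time ξ hp, hgg' hp, h]
    ring
  | add h₁ h₂ ih₁ ih₂ =>
    obtain ⟨T₁, hT₁, h₁'⟩ := ih₁
    obtain ⟨T₂, hT₂, h₂'⟩ := ih₂
    refine ⟨_, hT₁.add hT₂, fun v hv p hp => ?_⟩
    rw [alongField_add (h₁.smooth fun D hD => hS D hD v hv) (h₂.smooth fun D hD => hS D hD v hv)
      ξ hp, h₁' v hv hp, h₂' v hv hp]

end Combination

lemma smooth_of_mem_pdLbOps {m n : ℕ} (D) (hD : D ∈ pdLbOps m n) (v : ℝ × E3 → ℝ)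
    (hv : SmoothOnHalf v) : SmoothOnHalf (D v) := by
  obtain ⟨l₁, l₂, -, -, rfl⟩ := hD
  exact smooth_foldr_pd (smooth_foldr_Lb hv l₂) l₁

lemma pdLbOps_mono {m m' n n' : ℕ} (hm : m ≤ m') (hn : n ≤ n') :
    pdLbOps m n ⊆ pdLbOps m' n' := by
  rintro _ ⟨l₁, l₂, h₁, h₂, rfl⟩
  exact ⟨l₁, l₂, h₁.trans hm, h₂.trans hn, rfl⟩

lemma exists_combination_Lb (l : List (Fin 3)) :
    ∃ T, IsCombination (pdLbOps 0 l.length) T ∧ ∀ v, SmoothOnHalf v →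
      EqOn (l.foldr Lb fun p => p.1⁻¹ * v p) (T v) halfSpace := by
  induction l with
  | nil =>
    exact ⟨_, .term (.const 1) ⟨[], [], le_rfl, le_rfl, rfl⟩, fun v _ p _ => by simp⟩
  | cons b l ih =>
    obtain ⟨T, hT, h⟩ := ih
    obtain ⟨T', hT', h'⟩ := hT.exists_alongField (S' := pdLbOps 0 (b :: l).length)
      (isAdmissible_boost b) smooth_of_mem_pdLbOps (pdLbOps_mono le_rfl (by simp)) (by
        rintro _ ⟨l₁, l₂, h₁, h₂, rfl⟩
        obtain rfl := List.length_eq_zero_iff.1 (Nat.le_zero.1 h₁)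
        refine ⟨[], b :: l₂, le_rfl, by simpa using h₂, ?_⟩
        simp only [List.foldr_cons, List.foldr_nil, Lb_eq_alongField b])
    refine ⟨T', hT', fun v hv => ?_⟩
    simp only [List.foldr_cons, Lb_eq_alongField b]
    exact (alongField_congr (h v hv) _).trans (h' v hv)

lemma exists_combination_pd_Lb (l₁ : List (Fin 4)) (l₂ : List (Fin 3)) :
    ∃ T, IsCombination (pdLbOps l₁.length l₂.length) T ∧ ∀ v, SmoothOnHalf v →
      EqOn (l₁.foldr pd (l₂.foldr Lb fun p => p.1⁻¹ * v p)) (T v) halfSpace := by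
  induction l₁ with
  | nil => exact exists_combination_Lb l₂
  | cons α l ih =>
    obtain ⟨T, hT, h⟩ := ih
    obtain ⟨T', hT', h'⟩ := hT.exists_alongField (S' := pdLbOps (α :: l).length l₂.length)
      (isAdmissible_translation α) smooth_of_mem_pdLbOps (pdLbOps_mono (by simp) le_rfl) (by
        rintro _ ⟨k₁, k₂, h₁, h₂, rfl⟩
        exact ⟨α :: k₁, k₂, by simpa using h₁, h₂, rfl⟩)
    exact ⟨T', hT', fun v hv => (alongField_congr (h v hv) _).trans (h' v hv)⟩

/-- The semi-hyperboloidal derivative and its admissible derivatives are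
controlled, with a factor `t⁻¹`, by the boosts and translations applied to
`L_a u`:
`|∂^I L^J (∂̲_a u)| ≤ C t⁻¹ Σ_{|I'| ≤ |I|, |J'| ≤ |J|} |∂^{I'} L^{J'} (L_a u)|`
at points with `t ≥ 1`, `|x| ≤ t`. -/
theorem stmt18 (m n : ℕ) (I : Fin m → Fin 4) (J : Fin n → Fin 3) (a : Fin 3) :
    ∃ C : ℝ, 0 < C ∧
      ∀ u : ℝ × E3 → ℝ, ContDiffOn ℝ (⊤ : ℕ∞) u {p : ℝ × E3 | 0 < p.1} →
        ∀ p : ℝ × E3, 1 ≤ p.1 → ‖p.2‖ ≤ p.1 →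
          |pdF I (LbF J (sh a u)) p| ≤
            C * p.1⁻¹ *
              ∑ m' ∈ Finset.range (m + 1), ∑ n' ∈ Finset.range (n + 1),
                ∑ I' : Fin m' → Fin 4, ∑ J' : Fin n' → Fin 3,
                  |pdF I' (LbF J' (Lb a u)) p| := by
  obtain ⟨T, hT, hTu⟩ := exists_combination_pd_Lb (List.ofFn I) (List.ofFn J)
  obtain ⟨C, hC, hbound⟩ := hT.exists_bound
  refine ⟨C, hC, fun u hu p ht hx => ?_⟩
  have hv := smooth_Lb hu a
  have hp : p ∈ halfSpace := lt_of_lt_of_le one_pos ht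
  have hsh : EqOn (sh a u) (fun q => q.1⁻¹ * Lb a u q) halfSpace := by
    intro q hq
    have : q.1 ≠ 0 := ne_of_gt hq
    simp only [sh, Lb]
    field_simp
  have hkey : pdF I (LbF J (sh a u)) p = T (Lb a u) p :=
    (foldr_pd_congr (foldr_Lb_congr hsh _) _ hp).trans (hTu _ hv hp)
  rw [hkey]
  refine hbound _ _ p ht hx ?_
  rintro D ⟨l₁, l₂, h₁, h₂, rfl⟩
  rw [List.length_ofFn] at h₁ h₂
  have e : l₁.foldr pd (l₂.foldr Lb (Lb a u)) p = pdF l₁.get (LbF l₂.get (Lb a u)) p := by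
    simp only [pdF, LbF, List.ofFn_get]
  simp only [e]
  have hJ := Finset.single_le_sum (f := fun J' : Fin l₂.length → Fin 3 =>
    |pdF l₁.get (LbF J' (Lb a u)) p|) (fun _ _ => abs_nonneg _) (Finset.mem_univ l₂.get)
  have hI := Finset.single_le_sum (f := fun I' : Fin l₁.length → Fin 4 =>
    ∑ J' : Fin l₂.length → Fin 3, |pdF I' (LbF J' (Lb a u)) p|)
    (fun _ _ => by positivity) (Finset.mem_univ l₁.get)
  have hn := Finset.single_le_sum (f := fun n' => ∑ I' : Fin l₁.length → Fin 4,
    ∑ J' : Fin n' → Fin 3, |pdF I' (LbF J' (Lb a u)) p|)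
    (fun _ _ => by positivity) (Finset.mem_range.2 (Nat.lt_succ_of_le h₂))
  have hm := Finset.single_le_sum (f := fun m' => ∑ n' ∈ Finset.range (n + 1),
    ∑ I' : Fin m' → Fin 4, ∑ J' : Fin n' → Fin 3, |pdF I' (LbF J' (Lb a u)) p|)
    (fun _ _ => by positivity) (Finset.mem_range.2 (Nat.lt_succ_of_le h₁))
  exact hJ.trans (hI.trans (hn.trans hm))
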